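/- Relative decoding is a left inverse of relative encoding. Let V_{M'} ⪯ V_M be BPE vocabularies. For every token sequence e over V_{M'}, decode_{M→M'}(encode_{M'→M}(e)) = e. -/

import Mathlib

open scoped ENNReal

/-- A BPE vocabulary with `M` merge rules over alphabet `α` with end-of-string
symbol `eos`.  The `i`-th merged token (0-based) is `left i ++ right i`, where each
of `left i`, `right i` is either a single non-`eos` alphabet symbol or an earlier
merged token.  Tokens of the vocabulary are pairwise distinct. -/
structure BPE (α : Type*) (eos : α) (M : ℕ) where
  left : ℕ → List α
  right : ℕ → List α
  left_ok : ∀ i < M, (∃ a : α, a ≠ eos ∧ left i = [a]) ∨ ∃ j < i, left i = left j ++ right j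
  right_ok : ∀ i < M, (∃ a : α, a ≠ eos ∧ right i = [a]) ∨ ∃ j < i, right i = left j ++ right j
  distinct : ∀ i < M, ∀ j < M, left i ++ right i = left j ++ right j → i = j

variable {α : Type*} [DecidableEq α] {eos : α} {M : ℕ}

/-- One merge pass: scan left to right, replacing each leftmost non-overlapping
adjacent pair `(l, r)` by the merged token `l ++ r`. -/
def mergeStep (l r : List α) : List (List α) → List (List α)
  | [] => []
  | [x] => [x]
  | x :: y :: rest =>
      if x = l ∧ y = r then (l ++ r) :: mergeStep l r rest
      else x :: mergeStep l r (y :: rest)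

/-- One demerge pass: replace every occurrence of the token `l ++ r` by the pair `(l, r)`. -/
def demergeStep (l r : List α) (e : List (List α)) : List (List α) :=
  (e.map fun t => if t = l ++ r then [l, r] else [t]).flatten

/-- `merge_{i+1}` (0-based index `i`). -/
def BPE.mergeAt (B : BPE α eos M) (i : ℕ) (e : List (List α)) : List (List α) :=
  mergeStep (B.left i) (B.right i) e

/-- `demerge_{i+1}` (0-based index `i`). -/
def BPE.demergeAt (B : BPE α eos M) (i : ℕ) (e : List (List α)) : List (List α) :=
  demergeStep (B.left i) (B.right i) e

/-- `B.encodeRel K n e` applies the merges with 0-based indices `K, K+1, …, K+n-1`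
in order; this is the relative encoding `encode_{K → K+n}`. -/
def BPE.encodeRel (B : BPE α eos M) (K : ℕ) : ℕ → List (List α) → List (List α)
  | 0, e => e
  | n + 1, e => B.mergeAt (K + n) (B.encodeRel K n e)

/-- `B.decodeRel K n e` applies the demerges with 0-based indices `K+n-1, …, K+1, K`
in order; this is the relative decoding `decode_{K+n → K}`. -/
def BPE.decodeRel (B : BPE α eos M) (K : ℕ) : ℕ → List (List α) → List (List α)
  | 0, e => e
  | n + 1, e => B.decodeRel K n (B.demergeAt (K + n) e)

/-- The canonical encoding `encode(s; N)` of a byte string `s` with the first `N` merges. -/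
def BPE.encode (B : BPE α eos M) (N : ℕ) (s : List α) : List (List α) :=
  B.encodeRel 0 N (s.map fun a => [a])

/-- `decode`: concatenate the byte strings of the tokens. -/
def decodeBytes (e : List (List α)) : List α := e.flatten

/-- An encoding over `V_N` is valid (canonical) if re-encoding its decoded string gives it back. -/
def BPE.Valid (B : BPE α eos M) (N : ℕ) (e : List (List α)) : Prop :=
  B.encode N (decodeBytes e) = e

/-- `t` is a token of the truncated vocabulary `V_N` (alphabet symbols and the first `N` merges). -/
def BPE.IsTok (B : BPE α eos M) (N : ℕ) (t : List α) : Prop :=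
  (∃ a : α, t = [a]) ∨ ∃ i < N, t = B.left i ++ B.right i

/-- `e` is a token sequence over the truncated vocabulary `V_N`. -/
def BPE.IsEnc (B : BPE α eos M) (N : ℕ) (e : List (List α)) : Prop :=
  ∀ t ∈ e, B.IsTok N t

/-- `e` (over `V_M`) is a relative cover encoding of `e'` (over `V_{M'}`):
(1) `e` is a prefix of the canonical `V_M`-encoding of some byte sequence terminating
with `eos`, and (2) writing `e = e₀ ++ [t]`, for some index `k < |e'|` the relative
decoding of `e₀` equals the first `k` tokens of `e'` and the remaining tokens
`e'.drop k` form a prefix of the relative decoding of the last token `t`. -/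
def BPE.IsCover (B : BPE α eos M) (M' : ℕ) (e' e : List (List α)) : Prop :=
  (∃ x : List α, x.getLast? = some eos ∧ e <+: B.encode M x) ∧
  ∃ (e₀ : List (List α)) (t : List α), e = e₀ ++ [t] ∧
    ∃ k < e'.length,
      B.decodeRel M' (M - M') e₀ = e'.take k ∧
      e'.drop k <+: B.decodeRel M' (M - M') [t]

/-- The set `cover_{M'→M}(e')` of all relative cover encodings of `e'`. -/
def BPE.cover (B : BPE α eos M) (M' : ℕ) (e' : List (List α)) : Set (List (List α)) :=
  {e | B.IsCover M' e' e}

/-- `P_μ(e; N)`: the probability, under the language model `μ` on byte sequences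
terminating with `eos`, that the canonical `V_N`-encoding begins with `e`. -/
noncomputable def BPE.Pr (B : BPE α eos M) (N : ℕ)
    (μ : PMF {x : List α // x.getLast? = some eos}) (e : List (List α)) : ℝ≥0∞ :=
  μ.toOuterMeasure {x | e <+: B.encode N x.val}


theorem demergeStep_mergeStep {α : Type*} [DecidableEq α] (l r : List α) (e : List (List α))
    (h : l ++ r ∉ e) : demergeStep l r (mergeStep l r e) = e := by
  fun_induction mergeStep l r e <;> grind [demergeStep]

theorem mem_or_eq_append_of_mem_mergeStep {α : Type*} [DecidableEq α] {l r : List α}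
    {e : List (List α)} {t : List α} (h : t ∈ mergeStep l r e) : t ∈ e ∨ t = l ++ r := by
  fun_induction mergeStep l r e <;> simp_all <;> tauto

theorem BPE.left_ne_nil_and_right_ne_nil {α : Type*} {eos : α} {M : ℕ} (B : BPE α eos M)
    {i : ℕ} (hi : i < M) : B.left i ≠ [] ∧ B.right i ≠ [] := by
  induction i using Nat.strong_induction_on with
  | _ i ih =>
    constructor
    · rcases B.left_ok i hi with ⟨a, -, h⟩ | ⟨j, hj, h⟩
      · simp [h]
      · simp [h, (ih j hj (hj.trans hi)).1]
    · rcases B.right_ok i hi with ⟨a, -, h⟩ | ⟨j, hj, h⟩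
      · simp [h]
      · simp [h, (ih j hj (hj.trans hi)).1]

theorem BPE.not_isTok_append {α : Type*} {eos : α} {M : ℕ} (B : BPE α eos M)
    {i : ℕ} (hi : i < M) : ¬ B.IsTok i (B.left i ++ B.right i) := by
  obtain ⟨hl, hr⟩ := B.left_ne_nil_and_right_ne_nil hi
  rintro (⟨a, h⟩ | ⟨j, hj, h⟩)
  · rcases List.append_eq_singleton_iff.1 h with h | h
    · exact hl h.1
    · exact hr h.2
  · exact hj.ne' (B.distinct i hi j (hj.trans hi) h)

theorem BPE.IsEnc.mergeAt {α : Type*} [DecidableEq α] {eos : α} {M : ℕ} {B : BPE α eos M}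
    {i : ℕ} {e : List (List α)} (he : B.IsEnc i e) : B.IsEnc (i + 1) (B.mergeAt i e) := by
  intro t ht
  rcases mem_or_eq_append_of_mem_mergeStep ht with h | h
  · exact (he t h).imp_right fun ⟨j, hj, h⟩ => ⟨j, hj.trans i.lt_succ_self, h⟩
  · exact Or.inr ⟨i, i.lt_succ_self, h⟩

theorem BPE.IsEnc.encodeRel {α : Type*} [DecidableEq α] {eos : α} {M : ℕ} {B : BPE α eos M}
    {K : ℕ} {e : List (List α)} (he : B.IsEnc K e) (n : ℕ) :
    B.IsEnc (K + n) (B.encodeRel K n e) := by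
  induction n with
  | zero => exact he
  | succ n ih => exact ih.mergeAt

theorem BPE.IsEnc.decodeRel_encodeRel {α : Type*} [DecidableEq α] {eos : α} {M : ℕ}
    {B : BPE α eos M} {K : ℕ} {e : List (List α)} (he : B.IsEnc K e) {n : ℕ} (hn : K + n ≤ M) :
    B.decodeRel K n (B.encodeRel K n e) = e := by
  induction n with
  | zero => rfl
  | succ n ih =>
    have hfresh : B.left (K + n) ++ B.right (K + n) ∉ B.encodeRel K n e := fun h =>
      B.not_isTok_append (by omega) (he.encodeRel n _ h)
    rw [BPE.encodeRel, BPE.decodeRel, BPE.mergeAt, BPE.demergeAt,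
      demergeStep_mergeStep _ _ _ hfresh]
    exact ih (by omega)

/-- **Relative decoding is a left inverse of relative encoding.** For `V_{M'} ⪯ V_M`
and every token sequence `e` over `V_{M'}`,
`decode_{M→M'}(encode_{M'→M}(e)) = e`. -/
theorem relative_decode_left_inverse {α : Type*} [DecidableEq α] [Fintype α] {eos : α}
    {M : ℕ} (B : BPE α eos M) (M' : ℕ) (hM : M' ≤ M)
    (e : List (List α)) (he : B.IsEnc M' e) :
    B.decodeRel M' (M - M') (B.encodeRel M' (M - M') e) = e :=
  he.decodeRel_encodeRel (by omega)
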